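/- For every definite Horn formula F and set of variables B, UCL(B,F) is logically equivalent to HCLOSE(RCN(B,F), UCL(B,F)). -/

import Mathlib

/-- A definite Horn clause: a finite body of variables implying a head variable. -/
structure Clause (V : Type) where
  body : Finset V
  head : V
deriving DecidableEq

variable {V : Type} [DecidableEq V]

/-- A model satisfies a clause when the head is true if the whole body is true. -/
def satClause (M : V → Prop) (c : Clause V) : Prop :=
  (∀ v ∈ c.body, M v) → M c.head

/-- A model satisfies a set of clauses when it satisfies each of them. -/
def satSet (M : V → Prop) (S : Set (Clause V)) : Prop :=
  ∀ c ∈ S, satClause M c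

/-- `EntV S A x`: the formula `S` together with the variables `A` entails variable `x`. -/
def EntV (S : Set (Clause V)) (A : Set V) (x : V) : Prop :=
  ∀ M : V → Prop, satSet M S → (∀ v ∈ A, M v) → M x

/-- `EntVS S A B`: `S ⊨ A → B`, i.e. `S` with `A` entails every variable of `B`. -/
def EntVS (S : Set (Clause V)) (A B : Set V) : Prop :=
  ∀ x ∈ B, EntV S A x

/-- `EntF S T`: `S` entails every clause of `T`. -/
def EntF (S T : Set (Clause V)) : Prop :=
  ∀ c ∈ T, EntV S (↑c.body) c.head

/-- Logical equivalence of two sets of clauses: same models. -/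
def EquivS (S T : Set (Clause V)) : Prop :=
  ∀ M : V → Prop, satSet M S ↔ satSet M T

/-- `BCN`: all variable consequences of `B` under the formula `S`. -/
def BCN (S : Set (Clause V)) (B : Set V) : Set V :=
  {x | EntV S B x}

/-- `RCN`: real consequences of `B` under `S`. -/
def RCN (S : Set (Clause V)) (B : Set V) : Set V :=
  {x | EntV S (BCN S B \ {x}) x}

/-- `F^x`: `F` without the clauses mentioning `x` in head or body. -/
def Fx (F : Finset (Clause V)) (x : V) : Finset (Clause V) :=
  F.filter (fun c => x ∉ c.body ∧ c.head ≠ x)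

/-- A formula is single-head when no two distinct clauses share the head. -/
def SingleHead (F : Finset (Clause V)) : Prop :=
  ∀ c ∈ F, ∀ d ∈ F, c.head = d.head → c = d

/-- `UCL(B,F)`: non-tautological clauses of `F` whose body is entailed by `B` according to `F`. -/
def UCL (B : Set V) (F : Finset (Clause V)) : Set (Clause V) :=
  {c | c ∈ F ∧ c.head ∉ c.body ∧ EntVS (↑F) B (↑c.body)}

/-- `UCL(B,G,F)`: clauses of `G` whose body is entailed by `B` according to `F`. -/
def UCL3 (B : Set V) (G F : Finset (Clause V)) : Set (Clause V) :=
  {c | c ∈ G ∧ EntVS (↑F) B (↑c.body)}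

/-- `SCL(B,F)`: clauses of strictly entailed bodies. -/
def SCL (B : Set V) (F : Finset (Clause V)) : Set (Clause V) :=
  {c | c.head ∉ c.body ∧ EntV (↑F) (↑c.body) c.head ∧
       EntVS (↑F) B (↑c.body) ∧ ¬ EntVS (↑F) (↑c.body) B}

/-- `BCL(B,F)`: clauses of equivalent bodies. -/
def BCL (B : Set V) (F : Finset (Clause V)) : Set (Clause V) :=
  {c | c.head ∉ c.body ∧ EntV (↑F) (↑c.body) c.head ∧
       EntVS (↑F) B (↑c.body) ∧ EntVS (↑F) (↑c.body) B}

/-- `HCLOSE(H,S)`: body-minimal non-tautological entailed clauses with head in `H`. -/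
def HCLOSE (H : Set V) (S : Set (Clause V)) : Set (Clause V) :=
  {c | EntV S (↑c.body) c.head ∧ c.head ∈ H ∧ c.head ∉ c.body ∧
       ∀ B'' : Finset V, B'' ⊂ c.body → ¬ EntV S (↑B'') c.head}

/-- One resolution step: resolve a clause of `S` into the body of `c`. -/
def Step (S : Set (Clause V)) (c d : Clause V) : Prop :=
  ∃ e ∈ S, e.head ∈ c.body ∧ d = ⟨(c.body \ {e.head}) ∪ e.body, c.head⟩

/-- The head of a clause of `UCL B F` is a real consequence of `B` under `F`. -/
theorem head_mem_RCN_of_mem_UCL {F : Finset (Clause V)} {B : Set V} {c : Clause V}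
    (hc : c ∈ UCL B F) : c.head ∈ RCN (↑F) B := by
  obtain ⟨hF, hnot, hB⟩ := hc
  intro M hM hA
  refine hM c hF fun v hv => hA v ⟨hB v hv, ?_⟩
  rintro rfl
  exact hnot hv

/-- An entailed clause has a body-minimal entailed subclause. -/
theorem exists_minimal_body {S : Set (Clause V)} {A : Finset V} {x : V} (h : EntV S (↑A) x) :
    ∃ A' ⊆ A, EntV S (↑A') x ∧ ∀ A'' : Finset V, A'' ⊂ A' → ¬ EntV S (↑A'') x := by
  induction A using Finset.strongInduction with
  | H A ih =>
    by_cases hmin : ∃ A'' : Finset V, A'' ⊂ A ∧ EntV S (↑A'') x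
    · obtain ⟨A'', hss, hent⟩ := hmin
      obtain ⟨A', hsub, hA'⟩ := ih A'' hss hent
      exact ⟨A', hsub.trans hss.subset, hA'⟩
    · exact ⟨A, subset_rfl, h, fun A'' hss hent => hmin ⟨A'', hss, hent⟩⟩

theorem stmt17 (F : Finset (Clause V)) (B : Set V) :
    EquivS (UCL B F) (HCLOSE (RCN (↑F) B) (UCL B F)) := by
  intro M
  constructor
  · intro hM c hc hbody
    exact hc.1 M hM hbody
  · intro hM c hc hbody
    have hent : EntV (UCL B F) (↑c.body) c.head := fun N hN hb => hN c hc hb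
    obtain ⟨A, hsub, hA, hmin⟩ := exists_minimal_body hent
    have hhead := head_mem_RCN_of_mem_UCL hc
    exact hM ⟨A, c.head⟩ ⟨hA, hhead, fun h => hc.2.1 (hsub h), hmin⟩
      fun v hv => hbody v (hsub hv)
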